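/- arXiv:0902.0668 — 6 statements merged into one kernel-verified Lean document; each statement's English description precedes it below -/
import Mathlib

section
/- The standard realization π of the Heisenberg group H on ℂ(ZMod p) is irreducible: the only subspaces of ℂ(ZMod p) invariant under all operators π(h), h ∈ H, are {0} and the whole space. -/
open scoped BigOperators

noncomputable section

namespace DFTWeil

open scoped Classical

/-- Multiplication of the Heisenberg group `H = (V × V) × Z`,
`(v,z)·(v',z') = (v+v', z+z'+2⁻¹ ω(v,v'))` with `ω((t,w),(t',w')) = t w' - w t'`. -/
def hMul {p : ℕ} (a b : (ZMod p × ZMod p) × ZMod p) : (ZMod p × ZMod p) × ZMod p :=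
  (a.1 + b.1, a.2 + b.2 + (2 : ZMod p)⁻¹ * (a.1.1 * b.1.2 - a.1.2 * b.1.1))

/-- The additive character `ψ(z) = exp(2πi z/p)`. -/
def psi (p : ℕ) (z : ZMod p) : ℂ :=
  Complex.exp (2 * Real.pi * Complex.I * (z.val : ℂ) / p)

/-- The standard realization of the Heisenberg representation:
`(π((t,w),z) f)(x) = ψ(z + 2⁻¹ t w + w x) f(x+t)`. -/
def heis (p : ℕ) (h : (ZMod p × ZMod p) × ZMod p) :
    (ZMod p → ℂ) →ₗ[ℂ] (ZMod p → ℂ) where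
  toFun f x := psi p (h.2 + (2 : ZMod p)⁻¹ * h.1.1 * h.1.2 + h.1.2 * x) * f (x + h.1.1)
  map_add' f g := by funext x; simp [mul_add]
  map_smul' c f := by funext x; simp [Pi.smul_apply, smul_eq_mul]; ring

theorem psi_eq_stdAddChar {p : ℕ} [NeZero p] (z : ZMod p) :
    psi p z = ZMod.stdAddChar z := by
  have h := ZMod.stdAddChar_coe (N := p) (z.val : ℤ)
  simpa [psi] using h.symm

/-- Averaging the modulations `π((0,w),-w a)` over `w` gives `p` times evaluation at `a`. -/
theorem sum_heis_modulation {p : ℕ} [Fact p.Prime] (f : ZMod p → ℂ) (a : ZMod p) :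
    ∑ w : ZMod p, heis p ((0, w), -(w * a)) f = Pi.single a ((p : ℂ) * f a) := by
  funext x
  have hsum := AddChar.sum_mulShift (x - a) (ZMod.isPrimitive_stdAddChar p)
  have hterm (w : ZMod p) : heis p ((0, w), -(w * a)) f x =
      ZMod.stdAddChar (w * (x - a)) * f x := by
    simp only [heis, LinearMap.coe_mk, AddHom.coe_mk, psi_eq_stdAddChar, add_zero]
    congr 2
    ring
  rw [Finset.sum_apply, Finset.sum_congr rfl fun w _ => hterm w, ← Finset.sum_mul, hsum]
  by_cases hx : x = a
  · subst hx
    simp [ZMod.card]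
  · simp [hx, sub_eq_zero]

theorem heis_translation_single {p : ℕ} [NeZero p] (a t : ZMod p) (c : ℂ) :
    heis p ((t, 0), 0) (Pi.single a c) = Pi.single (a - t) c := by
  funext x
  simp [heis, psi, Pi.single_apply, eq_sub_iff_add_eq]

/-- The standard realization of the Heisenberg representation is irreducible. -/
theorem stmt2 (p : ℕ) [Fact p.Prime] (hp : p ≠ 2)
    (W : Submodule ℂ (ZMod p → ℂ))
    (hW : ∀ (h : (ZMod p × ZMod p) × ZMod p) (f : ZMod p → ℂ), f ∈ W → heis p h f ∈ W) :
    W = ⊥ ∨ W = ⊤ := by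
  refine or_iff_not_imp_left.mpr fun hne => ?_
  obtain ⟨f, hf, hf0⟩ := W.ne_bot_iff.mp hne
  obtain ⟨a, ha⟩ := Function.ne_iff.mp hf0
  have hsingle : Pi.single a ((p : ℂ) * f a) ∈ W := by
    rw [← sum_heis_modulation]
    exact W.sum_mem fun w _ => hW _ f hf
  have hc : (p : ℂ) * f a ≠ 0 :=
    mul_ne_zero (Nat.cast_ne_zero.mpr (Fact.out : p.Prime).ne_zero) ha
  have hall (b : ZMod p) : Pi.single b (1 : ℂ) ∈ W := by
    have h := hW ((a - b, 0), 0) _ hsingle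
    rw [heis_translation_single, sub_sub_cancel] at h
    have h' := W.smul_mem ((p : ℂ) * f a)⁻¹ h
    rwa [← Pi.single_smul, smul_eq_mul, inv_mul_cancel₀ hc] at h'
  rw [eq_top_iff, ← (Pi.basisFun ℂ (ZMod p)).span_eq, Submodule.span_le]
  rintro _ ⟨b, rfl⟩
  simpa using hall b

end DFTWeil
end
end

section
/- (Field-extension version) Let q = p^d with d ≥ 1 and let F_q be the field with q elements. Then the Fourier transform F_q[f](y) = q^(−1/2) · Σ_{x ∈ F_q} ψ_q(y·x)·f(x) on ℂ(F_q) satisfies F_q = (−1)^(d−1) · i^(d·(p−1)/2) · ρ_q(w), where w = [[0,1],[−1,0]] ∈ SL(2, F_q) and ρ_q(w) is given by the kernel formula ρ_q(w) = q⁻¹ · σ_q(−det(κ(w) + I)) · Σ_{v ∈ F_q²} ψ_q(4⁻¹·ω(κ(w)·v, v)) · π_q(v, 0) with κ(w) = (w + I)(w − I)⁻¹. -/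
open scoped BigOperators

noncomputable section

namespace DFTWeil

open scoped Classical

variable (p : ℕ) [Fact p.Prime] (K : Type) [Field K] [Fintype K] [Algebra (ZMod p) K]

/-- The additive character `ψ_q = ψ ∘ tr` of the field `K = F_q`. -/
def psiK (z : K) : ℂ := psi p (Algebra.trace (ZMod p) K z)

/-- The standard realization of the Heisenberg representation over `K`:
`(π_q((t,w),z) f)(x) = ψ_q(z + 2⁻¹ t w + w x) f(x+t)`. -/
def heisK (h : (K × K) × K) : (K → ℂ) →ₗ[ℂ] (K → ℂ) where
  toFun f x := psiK p K (h.2 + (2 : K)⁻¹ * h.1.1 * h.1.2 + h.1.2 * x) * f (x + h.1.1)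
  map_add' f g := by funext x; simp [mul_add]
  map_smul' c f := by funext x; simp [Pi.smul_apply, smul_eq_mul]; ring

/-- The quadratic character `σ_q` of `K` (extended by `0` at `0`). -/
def sgmK (a : K) : ℂ := if a = 0 then 0 else if IsSquare a then 1 else -1

/-- Action of a `2 × 2` matrix over `K` on a column vector `v ∈ K²`. -/
def matVecK (m : Matrix (Fin 2) (Fin 2) K) (v : K × K) : K × K :=
  (m 0 0 * v.1 + m 0 1 * v.2, m 1 0 * v.1 + m 1 1 * v.2)

/-- The symplectic form `ω((t,w),(t',w')) = t w' - w t'` on `K²`. -/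
def omgK (v w : K × K) : K := v.1 * w.2 - v.2 * w.1

/-- The Cayley transform `κ(g) = (g+I)(g-I)⁻¹`. -/
def cayleyK (g : Matrix (Fin 2) (Fin 2) K) : Matrix (Fin 2) (Fin 2) K :=
  (g + 1) * (g - 1)⁻¹

/-- The Weil operator over `K` given by the kernel formula
`ρ_q(g) = q⁻¹ σ_q(-det(κ(g)+I)) Σ_v ψ_q(4⁻¹ ω(κ(g)v,v)) π_q(v,0)`. -/
def weilOpK (g : Matrix (Fin 2) (Fin 2) K) : (K → ℂ) →ₗ[ℂ] (K → ℂ) :=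
  (Fintype.card K : ℂ)⁻¹ • sgmK K (-((cayleyK K g + 1).det)) •
    ∑ v : K × K,
      psiK p K ((4 : K)⁻¹ * omgK K (matVecK K (cayleyK K g) v) v) • heisK p K (v, 0)

/-- The Fourier transform `F_q[f](y) = q^(-1/2) Σ_x ψ_q(yx) f(x)` on `ℂ(F_q)`. -/
def dftK : (K → ℂ) →ₗ[ℂ] (K → ℂ) where
  toFun f y := ((Real.sqrt (Fintype.card K) : ℂ))⁻¹ * ∑ x : K, psiK p K (y * x) * f x
  map_add' f g := by funext y; simp [mul_add, Finset.sum_add_distrib]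
  map_smul' c f := by
    funext y
    simp [Pi.smul_apply, smul_eq_mul, Finset.mul_sum]
    ring_nf
    congr 1
    ext x
    ring


section
open Filter Topology Complex
open scoped Real

/-- The theta function tends to `1` at the cusp `i∞`, for real `z`. -/
lemma tendsto_jacobiTheta₂_one {α : Type*} {l : Filter α} {τ : α → ℂ}
    (hτ : Tendsto (fun t => (τ t).im) l atTop) (z : ℝ) :
    Tendsto (fun t => jacobiTheta₂ z (τ t)) l (𝓝 1) := by
  have hbound := summable_pow_mul_jacobiTheta₂_term_bound 0 one_pos 0
  have hlim : ∀ n : ℤ, Tendsto (fun t => jacobiTheta₂_term n z (τ t)) l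
      (𝓝 (if n = 0 then 1 else 0)) := by
    intro n
    rcases eq_or_ne n 0 with rfl | hn
    · simp [jacobiTheta₂_term, tendsto_const_nhds]
    · rw [if_neg hn, tendsto_zero_iff_norm_tendsto_zero]
      simp only [norm_jacobiTheta₂_term, ofReal_im, mul_zero, sub_zero]
      refine Real.tendsto_exp_atBot.comp ?_
      refine Tendsto.const_mul_atTop_of_neg ?_ hτ
      have : (0 : ℝ) < (n : ℝ) ^ 2 := by positivity
      nlinarith [Real.pi_pos]
  have := tendsto_tsum_of_dominated_convergence hbound hlim (by
    filter_upwards [hτ.eventually_ge_atTop 1] with t ht n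
    simpa using norm_jacobiTheta₂_term_le one_pos (S := 0) (z := z) (by simp) ht n)
  simp only [tsum_ite_eq] at this
  exact this

/-- Expansion of the theta function near the rational cusp `r`, obtained by splitting the
defining series into residue classes modulo `N`. -/
lemma jacobiTheta₂_zero_add_eq_sum (N : ℕ) [NeZero N] (r : ℝ)
    (hr : ∀ m a : ℤ, cexp (π * I * (m * N + a) ^ 2 * r) = cexp (π * I * a ^ 2 * r))
    {u : ℂ} (hu : 0 < u.re) :
    jacobiTheta₂ 0 (r + I / (N ^ 2 * u)) = u ^ (1 / 2 : ℂ) *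
      ∑ a : Fin N, cexp (π * I * (a : ℂ) ^ 2 * r) *
        jacobiTheta₂ ((a / N : ℝ) : ℂ) (I * u) := by
  have hu0 : u ≠ 0 := by rintro rfl; simp at hu
  have hN : (N : ℂ) ≠ 0 := by exact_mod_cast NeZero.ne N
  have hpos : 0 < (u⁻¹).re := by
    rw [inv_re]; exact div_pos hu (normSq_pos.mpr hu0)
  have him : 0 < ((r : ℂ) + I / (N ^ 2 * u)).im := by
    have : (r : ℂ) + I / (N ^ 2 * u) = r + (((N : ℝ) ^ 2)⁻¹ : ℝ) * (I * u⁻¹) := by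
      push_cast; field_simp
    rw [this, add_im, ofReal_im, zero_add, im_ofReal_mul, I_mul_im]
    have : (0 : ℝ) < N := by exact_mod_cast Nat.pos_of_ne_zero (NeZero.ne N)
    positivity
  have hcpow : u ^ (1 / 2 : ℂ) ≠ 0 := by simp [cpow_eq_zero_iff, hu0]
  have hinner : ∀ a : Fin N, HasSum (fun m : ℤ => jacobiTheta₂_term (m * N + (a : ℕ)) 0
      (r + I / (N ^ 2 * u))) (cexp (π * I * (a : ℂ) ^ 2 * r) * (u ^ (1 / 2 : ℂ) *
        jacobiTheta₂ ((a / N : ℝ) : ℂ) (I * u))) := by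
    intro a
    have h1 := (hasSum_jacobiTheta₂_term (((a / N : ℝ) : ℂ) / (I * u) : ℂ) (τ := -1 / (I * u)) (by
      have : -1 / (I * u) = I * u⁻¹ := by field_simp; simp
      rw [this, I_mul_im]; exact hpos)).mul_left
        (cexp (π * I * (a : ℂ) ^ 2 * r) * cexp (-π * I * ((a / N : ℝ) : ℂ) ^ 2 / (I * u)))
    have h2 := jacobiTheta₂_functional_equation ((a / N : ℝ) : ℂ) (I * u)
    have h3 : -I * (I * u) = u := by rw [← mul_assoc]; simp
    rw [h3] at h2
    have h4 : u ^ (1 / 2 : ℂ) * jacobiTheta₂ ((a / N : ℝ) : ℂ) (I * u) =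
        cexp (-π * I * ((a / N : ℝ) : ℂ) ^ 2 / (I * u)) *
          jacobiTheta₂ (((a / N : ℝ) : ℂ) / (I * u)) (-1 / (I * u)) := by
      rw [h2]; field_simp
    rw [h4, ← mul_assoc]
    refine (congrArg (HasSum · _) (funext fun m => ?_)).mpr
      ((Equiv.neg ℤ).hasSum_iff.mpr h1)
    have h5 := hr m (a : ℕ)
    push_cast at h5
    rw [Function.comp_apply, Equiv.neg_apply, ← h5, jacobiTheta₂_term, jacobiTheta₂_term,
      ← Complex.exp_add, ← Complex.exp_add]
    congr 1
    push_cast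
    field_simp
    linear_combination (m * N + a : ℂ) ^ 2 * I_sq
  have htot := (Int.divModEquiv N).symm.hasSum_iff.mpr (hasSum_jacobiTheta₂_term 0 him)
  have hsum := (((Equiv.prodComm _ _).hasSum_iff).mpr htot).prod_fiberwise (g := fun a : Fin N =>
    cexp (π * I * (a : ℂ) ^ 2 * r) * (u ^ (1 / 2 : ℂ) *
        jacobiTheta₂ ((a / N : ℝ) : ℂ) (I * u))) (fun a => by
      simpa using hinner a)
  rw [hsum.unique (hasSum_fintype _), Finset.mul_sum]
  exact Finset.sum_congr rfl fun a _ => by ring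

/-- Evaluation of the quadratic Gauss sum (Landsberg–Schaar), by comparing both sides of the
theta functional equation near the cusp `2 / p`. -/
lemma one_sub_I_mul_sum_exp (p : ℕ) [NeZero p] :
    (1 - I) * ∑ a : Fin p, cexp (π * I * (a : ℂ) ^ 2 * (2 / p : ℝ)) =
      √p * (1 + (-I) ^ p) := by
  have hp0 : (p : ℂ) ≠ 0 := by exact_mod_cast NeZero.ne p
  have hpR : (0 : ℝ) < p := by exact_mod_cast Nat.pos_of_ne_zero (NeZero.ne p)
  have hsq : ((√p : ℝ) : ℂ) ^ 2 = p := by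
    rw [← ofReal_pow, Real.sq_sqrt hpR.le]; simp
  have hsq0 : ((√p : ℝ) : ℂ) ≠ 0 := by
    intro h; rw [h] at hsq; simp [eq_comm] at hsq; exact hp0 (by exact_mod_cast hsq)
  set τ : ℝ → ℂ := fun u => (2 / p : ℝ) + I / (p ^ 2 * u) with hτ
  set v : ℝ → ℂ := fun u => u + I / (2 * p) with hv
  have hvre : ∀ u, (v u).re = u := fun u => by
    have : I / (2 * (p : ℂ)) = ((2 * p : ℝ)⁻¹ : ℝ) * I := by push_cast; field_simp
    simp [hv, this]
  have key : ∀ u : ℝ, 0 < u →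
      (-I * τ u) ^ (1 / 2 : ℂ) * ∑ a : Fin p, cexp (π * I * (a : ℂ) ^ 2 * (2 / p : ℝ)) *
        jacobiTheta₂ ((a / p : ℝ) : ℂ) (I * u) =
      (1 + I / (2 * p * u)) ^ (1 / 2 : ℂ) *
        ∑ a : Fin 2, cexp (π * I * (a : ℂ) ^ 2 * (-p / 2 : ℝ)) *
          jacobiTheta₂ ((a / (2 : ℕ) : ℝ) : ℂ) (I * v u) := by
    intro u hu
    have hu0 : (u : ℂ) ≠ 0 := by exact_mod_cast hu.ne'
    have h1 := jacobiTheta₂_zero_add_eq_sum p (2 / p) (fun m a => by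
      rw [Complex.exp_eq_exp_iff_exists_int]
      exact ⟨m ^ 2 * p + 2 * m * a, by push_cast; field_simp; ring⟩) (u := u) (by simpa)
    have h2 := jacobiTheta₂_zero_add_eq_sum 2 (-p / 2) (fun m a => by
      rw [Complex.exp_eq_exp_iff_exists_int]
      exact ⟨-(m ^ 2 * p + m * p * a), by push_cast; field_simp; ring⟩) (u := v u)
        (by rw [hvre]; exact hu)
    have hτ0 : τ u ≠ 0 := by
      have h : τ u = (2 / p : ℝ) + ((p ^ 2 * u : ℝ)⁻¹ : ℝ) * I := by
        simp only [hτ]; push_cast; field_simp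
      have hre : (τ u).re = 2 / p := by
        rw [h, add_re, ofReal_re, re_ofReal_mul, I_re, mul_zero, add_zero]
      intro h0
      rw [h0, zero_re] at hre
      exact (div_pos two_pos hpR).ne hre
    have hinv : -1 / τ u = ((-p / 2 : ℝ) : ℂ) + I / (((2 : ℕ) : ℂ) ^ 2 * v u) := by
      have hv0 : v u ≠ 0 := by intro h; have := hvre u; rw [h] at this; simp at this; linarith
      rw [div_eq_iff hτ0]
      have hv0' : (p * 2 * u + I : ℂ) ≠ 0 := by
        intro h; apply hv0; simp only [hv]; field_simp; linear_combination h
      simp only [hv, hτ]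
      push_cast
      field_simp
      ring
    have h3 := jacobiTheta₂_functional_equation 0 (τ u)
    have h4 : (-I * τ u) ^ (1 / 2 : ℂ) ≠ 0 := by simp [cpow_eq_zero_iff, hτ0]
    have h5 : (v u) ^ (1 / 2 : ℂ) = (u : ℂ) ^ (1 / 2 : ℂ) * (1 + I / (2 * p * u)) ^ (1 / 2 : ℂ) := by
      have hvu : v u = u * (1 + I / (2 * p * u)) := by simp only [hv]; field_simp
      have hw : (1 + I / (2 * p * u) : ℂ) ≠ 0 := by
        intro h; rw [h, mul_zero] at hvu
        have := hvre u; rw [hvu] at this; simp at this; linarith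
      rw [hvu, cpow_def_of_ne_zero (mul_ne_zero hu0 hw), cpow_def_of_ne_zero hu0,
        cpow_def_of_ne_zero hw, ← Complex.exp_add, log_ofReal_mul hu hw, ofReal_log hu.le]
      ring_nf
    have h6 : (u : ℂ) ^ (1 / 2 : ℂ) ≠ 0 := by simp [cpow_eq_zero_iff, hu.ne']
    rw [hinv, zero_div, h2, h5] at h3
    rw [hτ] at h3 h4 ⊢
    simp only at h3 h4 ⊢
    rw [h1] at h3
    apply mul_left_cancel₀ h6
    have h7 : cexp (-π * I * 0 ^ 2 / ((2 / p : ℝ) + I / (p ^ 2 * u))) = 1 := by simp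
    rw [h7, mul_one, one_div_mul_eq_div, eq_div_iff h4] at h3
    linear_combination h3
  have hI : Tendsto (fun u : ℝ => I / ((u : ℝ) : ℂ)) atTop (𝓝 0) := by
    simpa [div_eq_mul_inv] using (tendsto_inv_atTop_zero (𝕜 := ℝ)).ofReal.const_mul I
  have hL : Tendsto (fun u : ℝ => (-I * τ u) ^ (1 / 2 : ℂ) *
      ∑ a : Fin p, cexp (π * I * (a : ℂ) ^ 2 * (2 / p : ℝ)) *
        jacobiTheta₂ ((a / p : ℝ) : ℂ) (I * u)) atTop
      (𝓝 ((1 - I) / √p * ∑ a : Fin p, cexp (π * I * (a : ℂ) ^ 2 * (2 / p : ℝ)) * 1)) := by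
    refine Tendsto.mul ?_ (tendsto_finsetSum _ fun a _ => Tendsto.mul tendsto_const_nhds
      (tendsto_jacobiTheta₂_one (by simp only [I_mul_im, ofReal_re]; exact tendsto_id) _))
    have h1 : (1 - I) / √p = (-I * (2 / p : ℝ)) ^ (1 / 2 : ℂ) := by
      have : (-I * (2 / p : ℝ)) = ((1 - I) / √p) ^ 2 := by
        rw [div_pow, hsq, sub_sq, I_sq]; push_cast; ring
      rw [this, one_div, sq_cpow_two_inv]
      rw [div_ofReal_re]
      simp [hpR]
    rw [h1]
    refine ((continuousAt_cpow_const ?_).tendsto).comp ?_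
    · right
      simp [hpR.ne']
    · refine Tendsto.const_mul _ ?_
      have := (hI.const_mul ((p : ℂ) ^ 2)⁻¹).const_add ((2 / p : ℝ) : ℂ)
      rw [mul_zero, add_zero] at this
      refine this.congr fun u => ?_
      simp only [hτ]
      congr 1
      rw [div_eq_mul_inv, div_eq_mul_inv, mul_inv]; ring
  have hR : Tendsto (fun u : ℝ => (1 + I / (2 * p * u)) ^ (1 / 2 : ℂ) *
        ∑ a : Fin 2, cexp (π * I * (a : ℂ) ^ 2 * (-p / 2 : ℝ)) *
          jacobiTheta₂ ((a / (2 : ℕ) : ℝ) : ℂ) (I * v u)) atTop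
      (𝓝 (1 * ∑ a : Fin 2, cexp (π * I * (a : ℂ) ^ 2 * (-p / 2 : ℝ)) * 1)) := by
    refine Tendsto.mul ?_ (tendsto_finsetSum _ fun a _ => Tendsto.mul tendsto_const_nhds
      (tendsto_jacobiTheta₂_one (by simp only [I_mul_im, hvre]; exact tendsto_id) _))
    have h1 : (1 : ℂ) = 1 ^ (1 / 2 : ℂ) := by simp
    conv => arg 3; rw [h1]
    refine ((continuousAt_cpow_const (by simp)).tendsto).comp ?_
    have := (hI.const_mul (2 * p : ℂ)⁻¹).const_add 1
    rw [mul_zero, add_zero] at this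
    refine this.congr fun u => ?_
    congr 1
    rw [div_eq_mul_inv, div_eq_mul_inv, mul_inv (2 * p : ℂ)]; ring
  have heq := tendsto_nhds_unique (hL.congr' ((eventually_gt_atTop 0).mono key)) hR
  have hexp : cexp (π * I * (-p / 2)) = (-I) ^ p := by
    rw [← Complex.exp_neg_pi_div_two_mul_I, ← Complex.exp_nat_mul]
    congr 1; ring
  simp only [mul_one, Fin.sum_univ_two, one_mul, Fin.val_zero, Fin.val_one, Nat.cast_zero,
    Nat.cast_one, ofReal_div, ofReal_neg, ofReal_natCast, ofReal_ofNat, one_pow, hexp,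
    ne_eq, OfNat.ofNat_ne_zero, not_false_eq_true, zero_pow, mul_zero, zero_mul,
    Complex.exp_zero] at heq
  rw [← heq, div_mul_eq_mul_div, mul_div_cancel₀ _ hsq0]
  push_cast
  rfl

end

lemma sum_addChar_mul_sq {F : Type*} [Field F] [Fintype F] [DecidableEq F]
    (hF : ringChar F ≠ 2) {ψ : AddChar F ℂ} (hψ : ψ ≠ 1) {a : F} (ha : a ≠ 0) :
    ∑ x, ψ (a * x ^ 2) = quadraticChar F a * ∑ x, ψ (x ^ 2) := by
  have key : ∀ b : F, b ≠ 0 → ∑ x, ψ (b * x ^ 2) = ∑ y, (quadraticChar F y : ℂ) * ψ (b * y) := by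
    intro b hb
    have h0 : ∑ y, ψ (b * y) = 0 := by
      rw [← AddChar.sum_eq_zero_of_ne_one hψ]
      exact Equiv.sum_comp (Equiv.mulLeft₀ b hb) (fun y => ψ y)
    have h1 : ∑ x, ψ (b * x ^ 2) = ∑ y, ((quadraticChar F y : ℂ) + 1) * ψ (b * y) := by
      rw [← Finset.sum_fiberwise_of_maps_to (g := fun x => x ^ 2) (t := Finset.univ)
        (fun _ _ => Finset.mem_univ _)]
      refine Finset.sum_congr rfl fun y _ => ?_
      have h2 := quadraticChar_card_sqrts hF y
      have h3 : ((quadraticChar F y : ℂ) + 1) =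
          ((Finset.univ.filter fun x : F => x ^ 2 = y).card : ℂ) := by
        rw [Set.toFinset_ofPred] at h2
        exact_mod_cast h2.symm
      rw [h3, ← nsmul_eq_mul, ← Finset.sum_const]
      refine Finset.sum_congr rfl fun x hx => ?_
      rw [(Finset.mem_filter.mp hx).2]
    simp only [h1, add_mul, one_mul, Finset.sum_add_distrib, h0, add_zero]
  have h1 := key 1 one_ne_zero
  simp only [one_mul] at h1
  rw [key a ha, h1, Finset.mul_sum, ← Equiv.sum_comp (Equiv.mulLeft₀ a ha)
    (fun y => (quadraticChar F a : ℂ) * ((quadraticChar F y : ℂ) * ψ y))]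
  refine Finset.sum_congr rfl fun y _ => ?_
  have h2 : (quadraticChar F a : ℂ) * quadraticChar F a = 1 := by
    have := quadraticChar_sq_one ha
    rw [sq] at this
    exact_mod_cast this
  simp only [Equiv.mulLeft₀_apply, map_mul, Int.cast_mul]
  linear_combination (-(quadraticChar F y : ℂ) * ψ (a * y)) * h2

/-- The quadratic character of the discriminant of the trace form. -/
lemma quadraticChar_prod_trace_sq (hp : p ≠ 2) {n : ℕ}
    (hn : Module.finrank (ZMod p) K = n)
    (b : Module.Basis (Fin n) (ZMod p) K)
    (hb : (Algebra.traceForm (ZMod p) K).IsOrthoᵢ b) :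
    quadraticChar (ZMod p) (∏ i, Algebra.trace (ZMod p) K (b i ^ 2)) = (-1) ^ (n - 1) := by
  have hp' : ringChar (ZMod p) ≠ 2 := by rwa [ZMod.ringChar_zmod_n]
  have : CharP K p := charP_of_injective_algebraMap (algebraMap (ZMod p) K).injective p
  set A := ∏ i, Algebra.trace (ZMod p) K (b i ^ 2) with hA
  have hA0 : A ≠ 0 := Finset.prod_ne_zero_iff.mpr fun i _ => by
    have := hb.not_isOrtho_basis_self_of_separatingLeft
      (traceForm_nondegenerate (ZMod p) K).1 i
    rwa [Algebra.traceForm_apply, ← sq] at this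
  set M : Matrix (Fin n) (Fin n) K := Matrix.of fun i j => b i ^ p ^ (j : ℕ) with hM
  have hcard : Fintype.card K = p ^ n := by
    rw [Module.card_eq_pow_finrank (K := ZMod p), ZMod.card, hn]
  have hMM : M * M.transpose =
      Matrix.diagonal fun i => algebraMap (ZMod p) K (Algebra.trace (ZMod p) K (b i ^ 2)) := by
    ext i j
    have h1 : (M * M.transpose) i j =
        algebraMap (ZMod p) K (Algebra.trace (ZMod p) K (b i * b j)) := by
      rw [FiniteField.algebraMap_trace_eq_sum_pow, hn, Finset.sum_range]
      simp [Matrix.mul_apply, hM, mul_pow]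
    rw [h1]
    rcases eq_or_ne i j with rfl | hij
    · rw [Matrix.diagonal_apply_eq, sq]
    · have h2 : Algebra.traceForm (ZMod p) K (b i) (b j) = 0 := hb hij
      rw [Matrix.diagonal_apply_ne _ hij, ← Algebra.traceForm_apply, h2, map_zero]
  have hD : M.det ^ 2 = algebraMap (ZMod p) K A := by
    have := congrArg Matrix.det hMM
    rwa [Matrix.det_mul, Matrix.det_transpose, Matrix.det_diagonal, ← map_prod, ← sq] at this
  have hD0 : M.det ≠ 0 := by
    intro h
    rw [h, zero_pow two_ne_zero, eq_comm, map_eq_zero] at hD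
    exact hA0 hD
  have hfrob : M.det ^ p = (-1) ^ (n - 1) * M.det := by
    have h1 := (frobenius K p).map_det M
    have h2 : (frobenius K p).mapMatrix M = M.submatrix id (finRotate n) := by
      ext i j
      simp only [RingHom.mapMatrix_apply, Matrix.map_apply, frobenius_def, Matrix.submatrix_apply,
        hM, Matrix.of_apply, id, ← pow_mul, ← pow_succ]
      cases n with
      | zero => exact j.elim0
      | succ n =>
        rcases eq_or_ne j (Fin.last n) with rfl | hj
        · rw [finRotate_last, Fin.val_last, ← hcard, FiniteField.pow_card]; simp
        · rw [coe_finRotate_of_ne_last hj]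
    rw [h2, Matrix.det_permute', sign_finRotate, frobenius_def] at h1
    simpa using h1
  have hodd : 2 * (p / 2) + 1 = p := Nat.two_mul_div_two_add_one_of_odd
    ((Fact.out : p.Prime).odd_of_ne_two hp)
  have hpow : M.det ^ (p - 1) = (-1) ^ (n - 1) := by
    apply mul_right_cancel₀ hD0
    rw [← pow_succ, Nat.sub_add_cancel (Fact.out : p.Prime).one_le, hfrob]
  have hK : ringChar K ≠ 2 := by rwa [ringChar.eq K p]
  have h3 : ((quadraticChar (ZMod p) A : ℤ) : K) = (((-1) ^ (n - 1) : ℤ) : K) := by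
    have h4 := quadraticChar_eq_pow_of_char_ne_two' hp' A
    rw [ZMod.card] at h4
    have h5 := congrArg (algebraMap (ZMod p) K) h4
    rw [map_intCast, map_pow, ← hD, ← pow_mul, show 2 * (p / 2) = p - 1 by omega, hpow] at h5
    rw [h5]; push_cast; rfl
  rcases quadraticChar_dichotomy hA0 with h | h <;>
  rcases neg_one_pow_eq_or ℤ (n - 1) with h' | h' <;> rw [h, h'] at h3 ⊢
  · exact absurd h3.symm (by simpa using Ring.neg_one_ne_one_of_char_ne_two hK)
  · exact absurd h3 (by simpa using Ring.neg_one_ne_one_of_char_ne_two hK)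

/-- The Hasse–Davenport relation for quadratic Gauss sums. -/
lemma sum_addChar_trace_sq (hp : p ≠ 2) {ψ : AddChar (ZMod p) ℂ} (hψ : ψ ≠ 1) {n : ℕ}
    (hn : Module.finrank (ZMod p) K = n) :
    ∑ x : K, ψ (Algebra.trace (ZMod p) K (x ^ 2)) =
      (-1) ^ (n - 1) * (∑ x : ZMod p, ψ (x ^ 2)) ^ n := by
  have hp' : ringChar (ZMod p) ≠ 2 := by rwa [ZMod.ringChar_zmod_n]
  have : Invertible (2 : ZMod p) := invertibleOfNonzero (Ring.two_ne_zero hp')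
  obtain ⟨b, hb⟩ := LinearMap.BilinForm.exists_orthogonal_basis (K := ZMod p) (V := K)
    (B := Algebra.traceForm (ZMod p) K) ⟨fun x y => by simp [Algebra.traceForm_apply, mul_comm]⟩
  subst hn
  have hdisc := quadraticChar_prod_trace_sq p K hp rfl b hb
  have ha : ∀ i, Algebra.trace (ZMod p) K (b i ^ 2) ≠ 0 := fun i => by
    have := hb.not_isOrtho_basis_self_of_separatingLeft
      (traceForm_nondegenerate (ZMod p) K).1 i
    rwa [Algebra.traceForm_apply, ← sq] at this
  have htr : ∀ c : Fin (Module.finrank (ZMod p) K) → ZMod p,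
      Algebra.trace (ZMod p) K ((b.equivFun.symm c) ^ 2) =
        ∑ i, Algebra.trace (ZMod p) K (b i ^ 2) * c i ^ 2 := by
    intro c
    rw [sq, ← Algebra.traceForm_apply, Module.Basis.equivFun_symm_apply, map_sum]
    simp only [LinearMap.sum_apply, map_sum, map_smul, LinearMap.smul_apply, smul_eq_mul]
    refine Finset.sum_congr rfl fun i _ => ?_
    rw [Finset.sum_eq_single i]
    · rw [Algebra.traceForm_apply, ← sq]; ring
    · intro j _ hj
      have : Algebra.traceForm (ZMod p) K (b j) (b i) = 0 := hb hj
      simp [this]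
    · simp
  have hsum : ∀ f : Fin (Module.finrank (ZMod p) K) → ZMod p, ψ (∑ i, f i) = ∏ i, ψ (f i) :=
    fun f => map_prod ψ.toMonoidHom (fun i => Multiplicative.ofAdd (f i)) Finset.univ
  rw [← b.equivFun.symm.toEquiv.sum_comp]
  simp only [LinearEquiv.coe_toEquiv, htr, hsum]
  rw [← Fintype.prod_sum (fun i (c : ZMod p) => ψ (Algebra.trace (ZMod p) K (b i ^ 2) * c ^ 2))]
  simp only [sum_addChar_mul_sq hp' hψ (ha _), Finset.prod_mul_distrib, Finset.prod_const,
    Finset.card_univ, Fintype.card_fin]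
  rw [map_prod] at hdisc
  congr 1
  exact_mod_cast hdisc

section
open Complex

/-- The quadratic Gauss sum modulo an odd prime `p` has modulus `√p` and argument determined
by `p` modulo `8`. -/
lemma sum_stdAddChar_sq_mul_I_pow {p : ℕ} [NeZero p] (hp : Odd p) :
    (ZMod.χ₈ p : ℂ) * (∑ x : ZMod p, ZMod.stdAddChar (x ^ 2)) * I ^ ((p - 1) / 2) = √(p : ℝ) := by
  have hG : ∑ x : ZMod p, ZMod.stdAddChar (x ^ 2) =
      ∑ a : Fin p, cexp (Real.pi * I * (a : ℂ) ^ 2 * (2 / p : ℝ)) := by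
    rw [← (ZMod.finEquiv p).toEquiv.sum_comp]
    refine Finset.sum_congr rfl fun a _ => ?_
    have h : (ZMod.finEquiv p).toEquiv a = ((a : ℕ) : ZMod p) := by
      obtain ⟨n, rfl⟩ := Nat.exists_eq_succ_of_ne_zero (NeZero.ne p)
      exact (Fin.cast_val_eq_self a).symm
    rw [h, ← Nat.cast_pow, ZMod.stdAddChar_apply, ZMod.toCircle_natCast]
    congr 1
    push_cast
    ring
  have h := one_sub_I_mul_sum_exp p
  rw [← hG] at h
  have h2 : (1 - I) * (1 + I) = 2 := by linear_combination -I_sq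
  obtain ⟨k, r, hpr, hr⟩ : ∃ k r, p = 8 * k + r ∧ (r = 1 ∨ r = 3 ∨ r = 5 ∨ r = 7) :=
    ⟨p / 8, p % 8, by omega, by obtain ⟨m, hm⟩ := hp; omega⟩
  have hexp : (p - 1) / 2 = 4 * k + (r - 1) / 2 := by omega
  have hI : I ^ ((p - 1) / 2) = I ^ ((r - 1) / 2) := by
    rw [hexp, pow_add, pow_mul, I_pow_four, one_pow, one_mul]
  have hnI : (-I) ^ p = (-I) ^ r := by
    have h8 : (-I) ^ 8 = 1 := by
      rw [Even.neg_pow (by decide), show 8 = 4 * 2 by rfl, pow_mul, I_pow_four, one_pow]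
    rw [hpr, pow_add, pow_mul, h8, one_pow, one_mul]
  have hχ : ZMod.χ₈ (p : ZMod 8) = ZMod.χ₈ ((r : ℕ) : ZMod 8) := by
    rw [ZMod.χ₈_nat_mod_eight p, ZMod.χ₈_nat_mod_eight r, hpr, Nat.mul_add_mod]
  have h0 : (1 - I) ≠ 0 := left_ne_zero_of_mul (h2 ▸ two_ne_zero)
  rw [hnI] at h
  rw [hI, hχ]
  apply mul_left_cancel₀ h0
  generalize ∑ x : ZMod p, ZMod.stdAddChar (x ^ 2) = G at h ⊢
  rcases hr with rfl | rfl | rfl | rfl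
  · have hc : ZMod.χ₈ ((1 : ℕ) : ZMod 8) = 1 := by decide
    rw [hc, show (1 - 1) / 2 = 0 from rfl]
    push_cast
    linear_combination h
  · have hc : ZMod.χ₈ ((3 : ℕ) : ZMod 8) = -1 := by decide
    rw [hc, show (3 - 1) / 2 = 1 from rfl]
    push_cast
    linear_combination (-I) * h + (√(p : ℝ) : ℂ) * (-1 + I ^ 2) * I_sq
  · have hc : ZMod.χ₈ ((5 : ℕ) : ZMod 8) = -1 := by decide
    rw [hc, show (5 - 1) / 2 = 2 from rfl]
    push_cast
    linear_combination h + ((√(p : ℝ) : ℂ) * (I - I ^ 3) + G * (I - 1)) * I_sq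
  · have hc : ZMod.χ₈ ((7 : ℕ) : ZMod 8) = 1 := by decide
    rw [hc, show (7 - 1) / 2 = 3 from rfl]
    push_cast
    linear_combination (-I) * h + ((√(p : ℝ) : ℂ) * (-1 + I ^ 2 - I ^ 4 + I ^ 6) + I * G * (1 - I)) * I_sq

end

/-- `ψ_q` as a bundled additive character. -/
def psiKChar : AddChar K ℂ :=
  ZMod.stdAddChar.compAddMonoidHom (Algebra.trace (ZMod p) K).toAddMonoidHom

lemma psiK_eq_psiKChar (z : K) : psiK p K z = psiKChar p K z := by
  simp only [psiKChar, AddChar.compAddMonoidHom_apply, LinearMap.toAddMonoidHom_coe,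
    ZMod.stdAddChar_apply, ZMod.toCircle_apply, psiK, psi]

lemma psiKChar_ne_one : psiKChar p K ≠ 1 := by
  intro h
  obtain ⟨x, hx⟩ := Algebra.trace_surjective (ZMod p) K 1
  have h1 : psiKChar p K x = 1 := by rw [h]; rfl
  have h2 : ZMod.stdAddChar (1 : ZMod p) = ZMod.stdAddChar (0 : ZMod p) := by
    rw [AddChar.map_zero_eq_one, ← h1, ← hx]; rfl
  exact one_ne_zero (ZMod.injective_stdAddChar h2)

lemma sgmK_eq_quadraticChar (a : K) : sgmK K a = (quadraticChar K a : ℂ) := by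
  rw [quadraticChar_apply, quadraticCharFun, sgmK]
  split_ifs <;> simp

lemma cayleyK_weyl (h2 : (2 : K) ≠ 0) : cayleyK K !![0, 1; -1, 0] = !![0, -1; 1, 0] := by
  have hinv : (!![0, 1; -1, 0] - 1 : Matrix (Fin 2) (Fin 2) K)⁻¹ =
      !![-(2 : K)⁻¹, -(2 : K)⁻¹; (2 : K)⁻¹, -(2 : K)⁻¹] := by
    apply Matrix.inv_eq_right_inv
    ext i j
    fin_cases i <;> fin_cases j <;> simp [Matrix.mul_apply, Fin.sum_univ_two, Matrix.one_apply] <;>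
      field_simp <;> norm_num
  rw [cayleyK, hinv]
  ext i j
  fin_cases i <;> fin_cases j <;> simp [Matrix.mul_apply, Fin.sum_univ_two, Matrix.one_apply] <;>
      field_simp <;> norm_num

/-- The Weil operator of the Weyl element is a multiple of the unnormalised Fourier transform. -/
lemma weilOpK_weyl_apply (h2 : (2 : K) ≠ 0) (f : K → ℂ) (x : K) :
    weilOpK p K !![0, 1; -1, 0] f x =
      (Fintype.card K : ℂ)⁻¹ * (sgmK K (-2) * ((∑ u, psiKChar p K (-1 * u ^ 2)) *
        ∑ y, psiKChar p K (x * y) * f y)) := by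
  have hdet : (!![0, -1; 1, 0] + 1 : Matrix (Fin 2) (Fin 2) K).det = 2 := by
    rw [Matrix.det_fin_two]; simp; norm_num
  have h4 : (4 : K) ≠ 0 := by
    rw [show (4 : K) = 2 * 2 by norm_num]; exact mul_ne_zero h2 h2
  rw [weilOpK, cayleyK_weyl K h2, hdet]
  simp only [LinearMap.smul_apply, LinearMap.sum_apply, Pi.smul_apply, Finset.sum_apply,
    smul_eq_mul]
  congr 2
  rw [Finset.sum_mul_sum, Finset.sum_comm, Fintype.sum_prod_type]
  refine Fintype.sum_equiv (Equiv.addLeft x) _ _ fun t => ?_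
  refine Fintype.sum_equiv ((Equiv.mulLeft₀ (2 : K)⁻¹ (inv_ne_zero h2)).trans
    (Equiv.subRight ((2 : K)⁻¹ * t + x))) _ _ fun w => ?_
  simp only [psiK_eq_psiKChar, heisK, LinearMap.coe_mk, AddHom.coe_mk, matVecK, omgK,
    Equiv.trans_apply, Equiv.coe_addLeft, Equiv.mulLeft₀_apply, Equiv.subRight_apply]
  rw [← mul_assoc, ← mul_assoc, ← AddChar.map_add_eq_mul, ← AddChar.map_add_eq_mul]
  congr 2
  simp
  field_simp
  ring
lemma sum_psiKChar_sq (hp : p ≠ 2) {d : ℕ} (hcard : Fintype.card K = p ^ d) :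
    ∑ u, psiKChar p K (u ^ 2) = (-1) ^ (d - 1) * (∑ x : ZMod p, ZMod.stdAddChar (x ^ 2)) ^ d := by
  refine sum_addChar_trace_sq p K hp (ψ := ZMod.stdAddChar) ?_ ?_
  · intro h
    have h2 : ZMod.stdAddChar (1 : ZMod p) = ZMod.stdAddChar (0 : ZMod p) := by
      rw [AddChar.map_zero_eq_one, h]; rfl
    exact one_ne_zero (ZMod.injective_stdAddChar h2)
  · rw [Module.card_eq_pow_finrank (K := ZMod p), ZMod.card] at hcard
    exact Nat.pow_right_injective (Fact.out : p.Prime).two_le hcard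

/-- Field-extension version: over `F_q`, `q = p^d`, the Fourier transform satisfies
`F_q = (-1)^(d-1) i^(d(p-1)/2) ρ_q(w)` for the Weyl element `w = [[0,1],[-1,0]]`. -/
theorem stmt9 (d : ℕ) (hd : 1 ≤ d) (hp : p ≠ 2) (hcard : Fintype.card K = p ^ d) :
    dftK p K =
      ((-1 : ℂ) ^ (d - 1) * Complex.I ^ (d * ((p - 1) / 2))) • weilOpK p K !![0, 1; -1, 0] := by
  have hK : ringChar K ≠ 2 := by
    have : CharP K p := charP_of_injective_algebraMap (algebraMap (ZMod p) K).injective p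
    rwa [ringChar.eq K p]
  have h2 : (2 : K) ≠ 0 := Ring.two_ne_zero hK
  have hchi : (quadraticChar K 2 : ℂ) = (ZMod.χ₈ p : ℂ) ^ d := by
    rw [quadraticChar_two hK, hcard]
    push_cast
    rw [map_pow]
    push_cast
    rfl
  have hneg : (quadraticChar K (-2) : ℂ) * quadraticChar K (-1) = quadraticChar K 2 := by
    rw [← Int.cast_mul, ← map_mul]
    norm_num
  have hsqrt : (√(Fintype.card K : ℝ) : ℂ) =
      (-1) ^ (d - 1) * Complex.I ^ (d * ((p - 1) / 2)) *
        (sgmK K (-2) * ∑ u, psiKChar p K (-1 * u ^ 2)) := by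
    have hs : (-1 : ℂ) ^ (d - 1) * (-1) ^ (d - 1) = 1 := by
      rw [← mul_pow]; simp
    have hpow : √((p : ℝ) ^ d) = √(p : ℝ) ^ d := by
      rw [Real.sqrt_eq_iff_mul_self_eq (by positivity) (by positivity), ← mul_pow,
        Real.mul_self_sqrt (Nat.cast_nonneg p)]
    rw [sgmK_eq_quadraticChar,
      sum_addChar_mul_sq hK (psiKChar_ne_one p K) (neg_ne_zero.mpr one_ne_zero),
      ← mul_assoc (quadraticChar K (-2) : ℂ), hneg, hchi, sum_psiKChar_sq p K hp hcard,
      hcard, Nat.cast_pow,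
      hpow, Complex.ofReal_pow,
      ← sum_stdAddChar_sq_mul_I_pow ((Fact.out : p.Prime).odd_of_ne_two hp), mul_pow, mul_pow,
      ← pow_mul, mul_comm ((p - 1) / 2) d]
    linear_combination (-(ZMod.χ₈ p : ℂ) ^ d * (∑ x : ZMod p, ZMod.stdAddChar (x ^ 2)) ^ d *
      Complex.I ^ (d * ((p - 1) / 2))) * hs
  have hq : (√(Fintype.card K : ℝ) : ℂ) * √(Fintype.card K : ℝ) = Fintype.card K := by
    rw [← Complex.ofReal_mul, Real.mul_self_sqrt (Nat.cast_nonneg _), Complex.ofReal_natCast]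
  have hq0 : (Fintype.card K : ℂ) ≠ 0 := Nat.cast_ne_zero.mpr Fintype.card_ne_zero
  have hr0 : (√(Fintype.card K : ℝ) : ℂ) ≠ 0 := left_ne_zero_of_mul (hq ▸ hq0)
  refine LinearMap.ext fun f => funext fun x => ?_
  rw [LinearMap.smul_apply, Pi.smul_apply, smul_eq_mul, weilOpK_weyl_apply p K h2]
  simp only [dftK, LinearMap.coe_mk, AddHom.coe_mk, psiK_eq_psiKChar]
  rw [inv_mul_eq_div, inv_mul_eq_div, mul_div_assoc', div_eq_div_iff hr0 hq0]
  generalize ∑ y, psiKChar p K (x * y) * f y = S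
  linear_combination (-S) * hq + S * √(Fintype.card K : ℝ) * hsqrt

end DFTWeil
end
end

section
/- The centralizer T_w of w = [[0,1],[−1,0]] in SL(2, ZMod p) is a cyclic group, and its order is p − 1 if p ≡ 1 (mod 4) and p + 1 if p ≡ 3 (mod 4). -/
open scoped BigOperators

noncomputable section

namespace DFTWeil

open scoped Classical

/-- The Weyl element `w = [[0,1],[-1,0]]` as an element of `SL(2, ZMod p)`. -/
def wS (p : ℕ) [Fact p.Prime] : Matrix.SpecialLinearGroup (Fin 2) (ZMod p) :=
  ⟨!![0, 1; -1, 0], by simp [Matrix.det_fin_two_of]⟩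

/-- The centralizer of the Weyl element consists of the matrices `[[a, b], [-b, a]]`. -/
theorem mem_centralizer_wS_iff {p : ℕ} [Fact p.Prime]
    (g : Matrix.SpecialLinearGroup (Fin 2) (ZMod p)) :
    g ∈ Subgroup.centralizer {wS p} ↔ g 1 0 = -g 0 1 ∧ g 1 1 = g 0 0 := by
  have hw : (wS p : Matrix (Fin 2) (Fin 2) (ZMod p)) = !![0, 1; -1, 0] := rfl
  rw [Subgroup.mem_centralizer_singleton_iff, Matrix.SpecialLinearGroup.ext_iff]
  simp only [Matrix.SpecialLinearGroup.coe_mul, hw, Matrix.mul_apply, Fin.sum_univ_two,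
    Fin.forall_fin_two]
  simp
  grind

/-- The centralizer of the Weyl element is the unit circle `x ^ 2 + y ^ 2 = 1`. -/
def centralizerEquivCircle (p : ℕ) [Fact p.Prime] :
    ↥(Subgroup.centralizer {wS p}) ≃ {x : ZMod p × ZMod p // x.1 ^ 2 + x.2 ^ 2 = 1} where
  toFun g := ⟨(g.1 0 0, g.1 0 1), by
    have h := (mem_centralizer_wS_iff g.1).1 g.2
    have hdet := g.1.det_coe
    rw [Matrix.det_fin_two, h.1, h.2] at hdet
    linear_combination hdet⟩
  invFun x := ⟨⟨!![x.1.1, x.1.2; -x.1.2, x.1.1], by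
      rw [Matrix.det_fin_two_of]; linear_combination x.2⟩,
    (mem_centralizer_wS_iff _).2 (by simp)⟩
  left_inv g := by
    have h := (mem_centralizer_wS_iff g.1).1 g.2
    ext i j
    fin_cases i <;> fin_cases j <;> simp [h.1, h.2]
  right_inv x := by simp

/-- If `-1` is a square, the unit circle is a split torus. -/
theorem card_circle_of_sq_eq_neg_one {F : Type*} [Field F] (h2 : (2 : F) ≠ 0)
    {i : F} (hi : i ^ 2 = -1) :
    Nat.card {x : F × F // x.1 ^ 2 + x.2 ^ 2 = 1} = Nat.card Fˣ := by
  have hi0 : i ≠ 0 := by rintro rfl; simp at hi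
  refine Nat.card_congr
    { toFun := fun x => ⟨x.1.1 + i * x.1.2, x.1.1 - i * x.1.2,
        by linear_combination x.2 - x.1.2 ^ 2 * hi, by linear_combination x.2 - x.1.2 ^ 2 * hi⟩
      invFun := fun u => ⟨((u + (u⁻¹ : Fˣ)) / 2, (u - (u⁻¹ : Fˣ)) / (2 * i)), ?_⟩
      left_inv := ?_
      right_inv := ?_ }
  · have hu : (u : F) * (u⁻¹ : Fˣ) = 1 := u.mul_inv
    generalize ((u⁻¹ : Fˣ) : F) = v at *
    field_simp
    rw [hi]
    linear_combination -4 * hu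
  · rintro ⟨⟨x, y⟩, h⟩
    ext
    · simp only [Units.inv_mk]
      field_simp
      ring
    · simp only [Units.inv_mk]
      field_simp
      ring
  · intro u
    ext
    simp only
    field_simp
    ring

/-- If `-1` is not a square, stereographic projection identifies the unit circle with the
projective line. -/
theorem card_circle_of_sq_ne_neg_one {F : Type*} [Field F] [Finite F] (h2 : (2 : F) ≠ 0)
    (hF : ∀ t : F, t ^ 2 ≠ -1) :
    Nat.card {x : F × F // x.1 ^ 2 + x.2 ^ 2 = 1} = Nat.card F + 1 := by
  have hd (t : F) : 1 + t ^ 2 ≠ 0 := fun h => hF t (by linear_combination h)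
  rw [← Finite.card_option]
  let e : Option F ≃ {x : F × F // x.1 ^ 2 + x.2 ^ 2 = 1} := ?_
  · exact (Nat.card_congr e).symm
  refine
    { toFun := fun o => o.elim ⟨(-1, 0), by simp⟩
        fun t => ⟨((1 - t ^ 2) / (1 + t ^ 2), 2 * t / (1 + t ^ 2)), ?_⟩
      invFun := fun x => if x.1.1 = -1 then none else some (x.1.2 / (1 + x.1.1))
      left_inv := ?_
      right_inv := ?_ }
  · have := hd t
    field_simp
    ring
  · rintro (_ | t)
    · simp
    · have := hd t
      have hne : (1 - t ^ 2) / (1 + t ^ 2) ≠ -1 := by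
        rw [Ne, div_eq_iff this]
        exact fun h => h2 (by linear_combination h)
      have hsum : 1 + (1 - t ^ 2) / (1 + t ^ 2) = 2 / (1 + t ^ 2) := by
        field_simp
        ring
      simp only [Option.elim_some, if_neg hne, hsum, Option.some.injEq]
      field_simp
  · rintro ⟨⟨x, y⟩, h⟩
    simp only at h
    by_cases hx : x = -1
    · subst hx
      have hy : y = 0 := by
        have : y ^ 2 = 0 := by linear_combination h
        exact pow_eq_zero_iff two_ne_zero |>.1 this
      simp [hy]
    · have hx' : 1 + x ≠ 0 := fun h => hx (by linear_combination h)
      have hs : 1 + (y / (1 + x)) ^ 2 = 2 / (1 + x) := by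
        field_simp
        linear_combination h
      ext
      · simp only [if_neg hx, Option.elim_some, hs]
        field_simp
        linear_combination -h
      · simp only [if_neg hx, Option.elim_some, hs]
        field_simp

/-- The embedding `[[a, b], [-b, a]] ↦ a + i b` of the centralizer of the Weyl element into a
field containing a square root `i` of `-1`. -/
def centralizerHom (p : ℕ) [Fact p.Prime] {K : Type*} [Field K] [Algebra (ZMod p) K] {i : K}
    (hi : i ^ 2 = -1) : ↥(Subgroup.centralizer {wS p}) →* K where
  toFun g := algebraMap (ZMod p) K (g.1 0 0) + i * algebraMap (ZMod p) K (g.1 0 1)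
  map_one' := by simp
  map_mul' g h := by
    have hh := (mem_centralizer_wS_iff h.1).1 h.2
    simp only [Subgroup.coe_mul, Matrix.SpecialLinearGroup.coe_mul, Matrix.mul_apply,
      Fin.sum_univ_two, hh.1, hh.2, map_add, map_mul, map_neg]
    linear_combination (-algebraMap (ZMod p) K (g.1 0 1) * algebraMap (ZMod p) K (h.1 0 1)) * hi

theorem centralizerHom_injective (p : ℕ) [Fact p.Prime] {K : Type*} [Field K]
    [Algebra (ZMod p) K] (h2 : (2 : K) ≠ 0) {i : K} (hi : i ^ 2 = -1) :
    Function.Injective (centralizerHom p hi) := by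
  have hi0 : i ≠ 0 := by rintro rfl; simp at hi
  intro g h hgh
  have norm_eq_one (k : ↥(Subgroup.centralizer {wS p})) :
      algebraMap (ZMod p) K (k.1 0 0) ^ 2 + algebraMap (ZMod p) K (k.1 0 1) ^ 2 = 1 := by
    simpa [centralizerEquivCircle] using
      congrArg (algebraMap (ZMod p) K) (centralizerEquivCircle p k).2
  have hg := norm_eq_one g
  have hh := norm_eq_one h
  simp only [centralizerHom, MonoidHom.coe_mk, OneHom.coe_mk] at hgh
  apply (centralizerEquivCircle p).injective
  have inj := (algebraMap (ZMod p) K).injective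
  suffices algebraMap (ZMod p) K (g.1 0 0) = algebraMap (ZMod p) K (h.1 0 0) ∧
      algebraMap (ZMod p) K (g.1 0 1) = algebraMap (ZMod p) K (h.1 0 1) from
    Subtype.ext (Prod.ext (inj this.1) (inj this.2))
  generalize algebraMap (ZMod p) K (g.1 0 0) = a at *
  generalize algebraMap (ZMod p) K (g.1 0 1) = b at *
  generalize algebraMap (ZMod p) K (h.1 0 0) = c at *
  generalize algebraMap (ZMod p) K (h.1 0 1) = d at *
  have hconj : a - i * b = c - i * d := by
    have h1 : (a + i * b) * (a - i * b) = 1 := by linear_combination hg - b ^ 2 * hi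
    have h3 : (a + i * b) * (c - i * d) = 1 := by
      rw [hgh]; linear_combination hh - d ^ 2 * hi
    exact mul_left_cancel₀ (left_ne_zero_of_mul_eq_one h1) (h1.trans h3.symm)
  exact ⟨mul_left_cancel₀ h2 (by linear_combination hgh + hconj),
    mul_left_cancel₀ (mul_ne_zero h2 hi0) (by linear_combination hgh - hconj)⟩

/-- The centralizer of the Weyl element is cyclic, of order `p - 1` when `p ≡ 1 (mod 4)`
and of order `p + 1` when `p ≡ 3 (mod 4)`. -/
theorem stmt11 (p : ℕ) [Fact p.Prime] (hp : p ≠ 2) :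
    IsCyclic ↥(Subgroup.centralizer {wS p}) ∧
    (p % 4 = 1 → Nat.card ↥(Subgroup.centralizer {wS p}) = p - 1) ∧
    (p % 4 = 3 → Nat.card ↥(Subgroup.centralizer {wS p}) = p + 1) := by
  have h2 : (2 : ZMod p) ≠ 0 := Ring.two_ne_zero (by rwa [ZMod.ringChar_zmod_n])
  refine ⟨?_, fun h => ?_, fun h => ?_⟩
  · obtain ⟨i, hi⟩ := IsAlgClosed.exists_pow_nat_eq (-1 : AlgebraicClosure (ZMod p)) two_pos
    have h2' : (2 : AlgebraicClosure (ZMod p)) ≠ 0 := by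
      rw [← map_ofNat (algebraMap (ZMod p) (AlgebraicClosure (ZMod p))) 2]
      exact (map_ne_zero _).2 h2
    exact isCyclic_of_injective_ringHom _ (centralizerHom_injective p h2' hi)
  · obtain ⟨i, hi⟩ := ZMod.exists_sq_eq_neg_one_iff.2 (by lia : p % 4 ≠ 3)
    rw [Nat.card_congr (centralizerEquivCircle p),
      card_circle_of_sq_eq_neg_one h2 ((sq i).trans hi.symm), Nat.card_eq_fintype_card,
      ZMod.card_units]
  · rw [Nat.card_congr (centralizerEquivCircle p), card_circle_of_sq_ne_neg_one h2, Nat.card_zmod]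
    exact fun t ht => ZMod.exists_sq_eq_neg_one_iff.1 ⟨t, ht.symm.trans (sq t)⟩ h

end DFTWeil
end
end

section
/- (Split type of the torus of the DFT) Let T_w be the centralizer of w = [[0,1],[−1,0]] in SL(2, ZMod p) and let A = {[[a,0],[0,a⁻¹]] : a ∈ (ZMod p)ˣ} be the diagonal subgroup. If p ≡ 1 (mod 4), then there exists s ∈ SL(2, ZMod p) with s·T_w·s⁻¹ = A; if p ≡ 3 (mod 4), then no s ∈ SL(2, ZMod p) satisfies s·T_w·s⁻¹ = A. -/
open scoped BigOperators

noncomputable section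

namespace DFTWeil

open scoped Classical

section Centralizer

variable {K : Type*} [Field K]

theorem mul_comm_rotation_iff (m : Matrix (Fin 2) (Fin 2) K) :
    m * !![0, 1; -1, 0] = !![0, 1; -1, 0] * m ↔ m = !![m 0 0, m 0 1; -m 0 1, m 0 0] := by
  constructor
  · intro h
    have h₀ := congrFun (congrFun h 0) 0
    have h₁ := congrFun (congrFun h 0) 1
    simp [Matrix.mul_apply, Fin.sum_univ_two] at h₀ h₁
    ext i j
    fin_cases i <;> fin_cases j <;> simp [← h₀, ← h₁]
  · intro h
    rw [h]
    ext i j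
    fin_cases i <;> fin_cases j <;> simp [Matrix.mul_apply, Fin.sum_univ_two]

theorem exists_conj_centralizer_rotation_eq_diagonal (h₂ : (2 : K) ≠ 0) {i : K}
    (hi : i ^ 2 = -1) :
    ∃ s : Matrix (Fin 2) (Fin 2) K, s.det = 1 ∧
      (fun m => s * m * s⁻¹) ''
          {m : Matrix (Fin 2) (Fin 2) K |
            m.det = 1 ∧ m * !![0, 1; -1, 0] = !![0, 1; -1, 0] * m} =
        {m : Matrix (Fin 2) (Fin 2) K | ∃ a : K, a ≠ 0 ∧ m = !![a, 0; 0, a⁻¹]} := by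
  have hdet : (!![i, 1; -2⁻¹, -i * 2⁻¹] : Matrix (Fin 2) (Fin 2) K).det = 1 := by
    rw [Matrix.det_fin_two_of]
    field_simp
    linear_combination -hi
  have hconj (a b : K) : !![i, 1; -2⁻¹, -i * 2⁻¹] * !![a, b; -b, a] *
      (!![i, 1; -2⁻¹, -i * 2⁻¹] : Matrix (Fin 2) (Fin 2) K)⁻¹ =
        !![a + i * b, 0; 0, a - i * b] := by
    rw [Matrix.inv_def, hdet, Ring.inverse_one, one_smul, Matrix.adjugate_fin_two_of]
    ext j k
    fin_cases j <;> fin_cases k <;> simp [Matrix.mul_apply, Fin.sum_univ_two] <;>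
      field_simp <;> grind
  refine ⟨_, hdet, Set.ext fun n => ⟨?_, ?_⟩⟩
  · rintro ⟨m, ⟨hm, hcomm⟩, rfl⟩
    rw [mul_comm_rotation_iff] at hcomm
    rw [hcomm, Matrix.det_fin_two_of] at hm
    have hprod : (m 0 0 + i * m 0 1) * (m 0 0 - i * m 0 1) = 1 := by
      linear_combination hm - m 0 1 ^ 2 * hi
    refine ⟨m 0 0 + i * m 0 1, left_ne_zero_of_mul_eq_one hprod, ?_⟩
    rw [← eq_inv_of_mul_eq_one_right hprod, ← hconj, ← hcomm]
  · rintro ⟨a, ha, rfl⟩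
    refine ⟨!![(a + a⁻¹) / 2, -i * (a - a⁻¹) / 2; -(-i * (a - a⁻¹) / 2), (a + a⁻¹) / 2],
      ⟨?_, (mul_comm_rotation_iff _).2 (by simp)⟩, ?_⟩
    · rw [Matrix.det_fin_two_of]
      field_simp
      linear_combination (a ^ 2 - 1) ^ 2 * hi
    · change _ * _ * _ = _
      rw [hconj]
      congr <;> field_simp <;> grind

theorem sq_eq_neg_one_of_conj_rotation_eq_diagonal {s : Matrix (Fin 2) (Fin 2) K}
    (hs : s.det = 1) {a b : K} (h : s * !![0, 1; -1, 0] * s⁻¹ = !![a, 0; 0, b]) :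
    a ^ 2 = -1 := by
  have hw : (!![0, 1; -1, 0] * !![0, 1; -1, 0] : Matrix (Fin 2) (Fin 2) K) = -1 := by
    ext i j
    fin_cases i <;> fin_cases j <;> simp
  have hsq : !![a, 0; 0, b] * !![a, 0; 0, b] = -1 := by
    have hu : IsUnit s.det := by simp [hs]
    rw [← h, Matrix.mul_assoc (s * _), Matrix.mul_assoc s _ s⁻¹,
      Matrix.nonsing_inv_mul_cancel_left _ _ hu, ← Matrix.mul_assoc, Matrix.mul_assoc s, hw]
    simp [Matrix.mul_nonsing_inv _ hu]
  simpa [sq] using congrFun (congrFun hsq 0) 0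

end Centralizer

/-- The torus of the DFT is split iff `p ≡ 1 (mod 4)`: for `p ≡ 1 (mod 4)` some
`s ∈ SL(2, ZMod p)` conjugates the centralizer of `w` onto the diagonal torus, and for
`p ≡ 3 (mod 4)` no such `s` exists. -/
theorem stmt12 (p : ℕ) [Fact p.Prime] (hp : p ≠ 2) :
    (p % 4 = 1 → ∃ s : Matrix (Fin 2) (Fin 2) (ZMod p), s.det = 1 ∧
      (fun m => s * m * s⁻¹) ''
          {m : Matrix (Fin 2) (Fin 2) (ZMod p) |
            m.det = 1 ∧ m * !![0, 1; -1, 0] = !![0, 1; -1, 0] * m} =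
        {m : Matrix (Fin 2) (Fin 2) (ZMod p) |
          ∃ a : ZMod p, a ≠ 0 ∧ m = !![a, 0; 0, a⁻¹]}) ∧
    (p % 4 = 3 → ¬ ∃ s : Matrix (Fin 2) (Fin 2) (ZMod p), s.det = 1 ∧
      (fun m => s * m * s⁻¹) ''
          {m : Matrix (Fin 2) (Fin 2) (ZMod p) |
            m.det = 1 ∧ m * !![0, 1; -1, 0] = !![0, 1; -1, 0] * m} =
        {m : Matrix (Fin 2) (Fin 2) (ZMod p) |
          ∃ a : ZMod p, a ≠ 0 ∧ m = !![a, 0; 0, a⁻¹]}) := by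
  refine ⟨fun h => ?_, ?_⟩
  · obtain ⟨i, hi⟩ := ZMod.exists_sq_eq_neg_one_iff.2 (show p % 4 ≠ 3 by omega)
    exact exists_conj_centralizer_rotation_eq_diagonal
      (Ring.two_ne_zero (by rwa [ZMod.ringChar_zmod_n])) (by rw [sq, hi])
  · rintro h ⟨s, hs, heq⟩
    obtain ⟨a, -, ha⟩ := heq.subset ⟨!![0, 1; -1, 0], ⟨by simp [Matrix.det_fin_two_of], rfl⟩, rfl⟩
    exact ZMod.mod_four_ne_three_of_sq_eq_neg_one
      (sq_eq_neg_one_of_conj_rotation_eq_diagonal hs ha) h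

end DFTWeil
end
end

section
/- Suppose p ≡ 1 (mod 4) and let ε ∈ ZMod p satisfy ε² = −1. Then the matrix s = [[2⁻¹, ε·2⁻¹],[ε, 1]] lies in SL(2, ZMod p) and conjugates the centralizer of the Weyl element to the diagonal torus: s·T_w·s⁻¹ = A, where T_w = {g ∈ SL(2, ZMod p) : g·w = w·g} with w = [[0,1],[−1,0]], and A = {[[a,0],[0,a⁻¹]] : a ∈ (ZMod p)ˣ}. -/
open scoped BigOperators

noncomputable section

namespace DFTWeil

open scoped Classical

/-- The matrix `[[2⁻¹, ε 2⁻¹],[ε, 1]]` has determinant one when `2 ≠ 0` and `ε ^ 2 = -1`. -/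
theorem det_diagonalizer {K : Type*} [Field K] (h2 : (2 : K) ≠ 0) {ε : K} (hε : ε ^ 2 = -1) :
    (!![(2 : K)⁻¹, ε * (2 : K)⁻¹; ε, 1]).det = 1 := by
  rw [Matrix.det_fin_two_of]
  field_simp
  linear_combination -hε

/-- Over a field with `2 ≠ 0` and `ε ^ 2 = -1`, the matrix `[[2⁻¹, ε 2⁻¹],[ε, 1]]` diagonalizes
`[[x, y],[-y, x]]`, with eigenvalues `x - ε y` and `x + ε y`. -/
theorem conj_rotation_eq_diag {K : Type*} [Field K] (h2 : (2 : K) ≠ 0) {ε : K}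
    (hε : ε ^ 2 = -1) (x y : K) :
    !![(2 : K)⁻¹, ε * (2 : K)⁻¹; ε, 1] * !![x, y; -y, x] *
        (!![(2 : K)⁻¹, ε * (2 : K)⁻¹; ε, 1])⁻¹ = !![x - ε * y, 0; 0, x + ε * y] := by
  have hmul : !![(2 : K)⁻¹, ε * (2 : K)⁻¹; ε, 1] * !![x, y; -y, x] =
      !![x - ε * y, 0; 0, x + ε * y] * !![(2 : K)⁻¹, ε * (2 : K)⁻¹; ε, 1] := by
    ext i j
    fin_cases i <;> fin_cases j <;> simp
    · ring
    · linear_combination (y * 2⁻¹) * hε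
    · linear_combination -y * hε
    · ring
  rw [hmul, Matrix.mul_nonsing_inv_cancel_right _ _ (by simp [det_diagonalizer h2 hε])]

/-- The matrices commuting with the Weyl element `[[0, 1],[-1, 0]]` are the `[[x, y],[-y, x]]`. -/
theorem commute_weyl_iff {R : Type*} [CommRing R] (m : Matrix (Fin 2) (Fin 2) R) :
    m * !![0, 1; -1, 0] = !![0, 1; -1, 0] * m ↔ ∃ x y, m = !![x, y; -y, x] := by
  constructor
  · intro h
    have h00 := congrFun (congrFun h 0) 0
    have h01 := congrFun (congrFun h 0) 1
    simp [Matrix.mul_apply, Fin.sum_univ_two] at h00 h01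
    refine ⟨m 0 0, m 0 1, ?_⟩
    ext i j
    fin_cases i <;> fin_cases j <;> simp [h00, h01]
  · rintro ⟨x, y, rfl⟩
    simp

/-- For `p ≡ 1 (mod 4)` and `ε² = -1`, the matrix `s = [[2⁻¹, ε 2⁻¹],[ε, 1]]` lies in
`SL(2, ZMod p)` and conjugates the centralizer of the Weyl element onto the diagonal torus. -/
theorem stmt13 (p : ℕ) [Fact p.Prime] (hp4 : p % 4 = 1) (ε : ZMod p) (hε : ε ^ 2 = -1) :
    (!![(2 : ZMod p)⁻¹, ε * (2 : ZMod p)⁻¹; ε, 1]).det = 1 ∧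
    (fun m => !![(2 : ZMod p)⁻¹, ε * (2 : ZMod p)⁻¹; ε, 1] * m *
          (!![(2 : ZMod p)⁻¹, ε * (2 : ZMod p)⁻¹; ε, 1])⁻¹) ''
        {m : Matrix (Fin 2) (Fin 2) (ZMod p) |
          m.det = 1 ∧ m * !![0, 1; -1, 0] = !![0, 1; -1, 0] * m} =
      {m : Matrix (Fin 2) (Fin 2) (ZMod p) |
        ∃ a : ZMod p, a ≠ 0 ∧ m = !![a, 0; 0, a⁻¹]} := by
  have hp2 : p ≠ 2 := by rintro rfl; omega
  have h2 : (2 : ZMod p) ≠ 0 := Ring.two_ne_zero (by rwa [ZMod.ringChar_zmod_n])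
  refine ⟨det_diagonalizer h2 hε, Set.Subset.antisymm ?_ ?_⟩
  · rintro _ ⟨m, ⟨hdet, hm⟩, rfl⟩
    obtain ⟨x, y, rfl⟩ := (commute_weyl_iff m).mp hm
    rw [Matrix.det_fin_two_of] at hdet
    have hmul : (x - ε * y) * (x + ε * y) = 1 := by
      linear_combination hdet - y ^ 2 * hε
    exact ⟨x - ε * y, left_ne_zero_of_mul_eq_one hmul, by
      rw [← eq_inv_of_mul_eq_one_right hmul]
      exact conj_rotation_eq_diag h2 hε x y⟩
  · rintro _ ⟨a, ha, rfl⟩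
    refine ⟨!![(a + a⁻¹) / 2, ε * (a - a⁻¹) / 2; -(ε * (a - a⁻¹) / 2), (a + a⁻¹) / 2],
      ⟨?_, (commute_weyl_iff _).mpr ⟨_, _, rfl⟩⟩, ?_⟩
    · rw [Matrix.det_fin_two_of]
      field_simp
      linear_combination (a ^ 2 - 1) ^ 2 * hε
    · refine (conj_rotation_eq_diag h2 hε _ _).trans ?_
      have hx : (a + a⁻¹) / 2 - ε * (ε * (a - a⁻¹) / 2) = a := by
        field_simp
        linear_combination (1 - a ^ 2) * hε
      have hy : (a + a⁻¹) / 2 + ε * (ε * (a - a⁻¹) / 2) = a⁻¹ := by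
        field_simp
        linear_combination (a ^ 2 - 1) * hε
      rw [hx, hy]

end DFTWeil
end
end

section
/- (Character-space decomposition for a split torus) Consider the action of the group (ZMod p)ˣ on ℂ(ZMod p) by (a • f)(x) = σ(a)·f(a⁻¹·x). For a homomorphism χ : (ZMod p)ˣ → ℂˣ, let H_χ = {f ∈ ℂ(ZMod p) : a • f = χ(a)·f for all a ∈ (ZMod p)ˣ}. Then dim H_χ = 1 if χ ≠ σ and dim H_χ = 2 if χ = σ (where σ is viewed as a character of (ZMod p)ˣ). -/
open scoped BigOperators

noncomputable section

namespace DFTWeil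

open scoped Classical

/-- The Legendre character on the units of `ZMod p`. -/
def sgmU (p : ℕ) (a : (ZMod p)ˣ) : ℂ := if IsSquare a then 1 else -1

/-- The `χ`-character space for the action `(a • f)(x) = σ(a) f(a⁻¹ x)` of `(ZMod p)ˣ`
on `ℂ(ZMod p)`. -/
def charSpace (p : ℕ) (χ : (ZMod p)ˣ →* ℂˣ) : Submodule ℂ (ZMod p → ℂ) where
  carrier := {f | ∀ (a : (ZMod p)ˣ) (x : ZMod p),
    sgmU p a * f (((a⁻¹ : (ZMod p)ˣ) : ZMod p) * x) = (χ a : ℂ) * f x}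
  add_mem' := by
    intro f g hf hg a x
    simp only [Pi.add_apply, mul_add, hf a x, hg a x]
  zero_mem' := by intro a x; simp
  smul_mem' := by
    intro c f hf a x
    simp only [Pi.smul_apply, smul_eq_mul]
    rw [mul_left_comm, hf a x, mul_left_comm]

lemma sgmU_eq_quadraticChar (p : ℕ) [Fact p.Prime] (a : (ZMod p)ˣ) :
    sgmU p a = ((quadraticChar (ZMod p) (a : ZMod p) : ℤ) : ℂ) := by
  have hsq : IsSquare (a : ZMod p) ↔ IsSquare a := by
    constructor
    · rintro ⟨y, hy⟩
      have hy0 : y ≠ 0 := by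
        rintro rfl
        exact a.ne_zero (hy.trans (mul_zero 0))
      exact ⟨Units.mk0 y hy0, Units.ext (by simpa using hy)⟩
    · rintro ⟨y, rfl⟩
      exact ⟨y, by simp⟩
  rw [quadraticChar_apply, quadraticCharFun, if_neg a.ne_zero, sgmU]
  by_cases h : IsSquare a
  · rw [if_pos h, if_pos (hsq.mpr h), Int.cast_one]
  · rw [if_neg h, if_neg (mt hsq.mp h), Int.cast_neg, Int.cast_one]

lemma sgmU_mul (p : ℕ) [Fact p.Prime] (a b : (ZMod p)ˣ) :
    sgmU p (a * b) = sgmU p a * sgmU p b := by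
  simp only [sgmU_eq_quadraticChar, Units.val_mul, map_mul, Int.cast_mul]

lemma sgmU_one (p : ℕ) : sgmU p 1 = 1 := if_pos IsSquare.one

/-- The function supported on the units, with value `σ(a) χ(a)⁻¹` at `a`. -/
def unitFun (p : ℕ) (χ : (ZMod p)ˣ →* ℂˣ) (x : ZMod p) : ℂ :=
  if h : IsUnit x then sgmU p h.unit * ((χ h.unit : ℂ))⁻¹ else 0

lemma unitFun_unit (p : ℕ) (χ : (ZMod p)ˣ →* ℂˣ) (a : (ZMod p)ˣ) :
    unitFun p χ a = sgmU p a * (χ a : ℂ)⁻¹ := by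
  rw [unitFun, dif_pos a.isUnit, IsUnit.unit_of_val_units]

lemma unitFun_one (p : ℕ) (χ : (ZMod p)ˣ →* ℂˣ) : unitFun p χ 1 = 1 := by
  simpa [sgmU_one] using unitFun_unit p χ 1

lemma unitFun_zero (p : ℕ) [Fact p.Prime] (χ : (ZMod p)ˣ →* ℂˣ) : unitFun p χ 0 = 0 :=
  dif_neg not_isUnit_zero

lemma eq_zero_or_exists_unit {K : Type*} [Field K] (x : K) : x = 0 ∨ ∃ u : Kˣ, (u : K) = x :=
  (eq_or_ne x 0).imp_right fun h => ⟨Units.mk0 x h, rfl⟩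

lemma unitFun_mem_charSpace (p : ℕ) [Fact p.Prime] (χ : (ZMod p)ˣ →* ℂˣ) :
    unitFun p χ ∈ charSpace p χ := by
  intro a x
  obtain rfl | ⟨u, rfl⟩ := eq_zero_or_exists_unit x
  · rw [mul_zero, unitFun_zero, mul_zero, mul_zero]
  · have hu : sgmU p u = sgmU p a * sgmU p (a⁻¹ * u) := by rw [← sgmU_mul, mul_inv_cancel_left]
    have hχ : (χ (a⁻¹ * u) : ℂ)⁻¹ = χ a * (χ u : ℂ)⁻¹ := by
      simp [mul_comm]
    rw [← Units.val_mul, unitFun_unit, unitFun_unit, hu, hχ]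
    ring

lemma single_zero_mem_charSpace (p : ℕ) [Fact p.Prime] (χ : (ZMod p)ˣ →* ℂˣ)
    (h : ∀ a : (ZMod p)ˣ, (χ a : ℂ) = sgmU p a) :
    (Pi.single 0 1 : ZMod p → ℂ) ∈ charSpace p χ := by
  intro a x
  rw [h]
  obtain rfl | ⟨u, rfl⟩ := eq_zero_or_exists_unit x
  · rw [mul_zero]
  · rw [← Units.val_mul, Pi.single_eq_of_ne (Units.ne_zero _), Pi.single_eq_of_ne u.ne_zero]

lemma charSpace_apply_unit {p : ℕ} {χ : (ZMod p)ˣ →* ℂˣ} {f : ZMod p → ℂ}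
    (hf : f ∈ charSpace p χ) (a : (ZMod p)ˣ) : f a = f 1 * unitFun p χ a := by
  have h := hf a a
  rw [Units.inv_mul] at h
  rw [unitFun_unit, ← mul_assoc, eq_mul_inv_iff_mul_eq₀ (χ a).ne_zero]
  linear_combination -h

lemma charSpace_apply_zero {p : ℕ} {χ : (ZMod p)ˣ →* ℂˣ} {f : ZMod p → ℂ}
    (hf : f ∈ charSpace p χ) (hχ : ∃ a : (ZMod p)ˣ, (χ a : ℂ) ≠ sgmU p a) : f 0 = 0 := by
  obtain ⟨a, ha⟩ := hχ
  have h := hf a 0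
  rw [mul_zero] at h
  exact (mul_eq_mul_right_iff.mp h).resolve_left ha.symm

/-- Every element of the character space is determined by its values at `0` and `1`. -/
lemma eq_of_mem_charSpace {p : ℕ} [Fact p.Prime] {χ : (ZMod p)ˣ →* ℂˣ} {f : ZMod p → ℂ}
    (hf : f ∈ charSpace p χ) :
    f = f 1 • unitFun p χ + f 0 • (Pi.single 0 1 : ZMod p → ℂ) := by
  funext x
  obtain rfl | ⟨u, rfl⟩ := eq_zero_or_exists_unit x
  · simp [unitFun_zero]
  · simp [charSpace_apply_unit hf u]

lemma charSpace_eq_span_unitFun (p : ℕ) [Fact p.Prime] (χ : (ZMod p)ˣ →* ℂˣ)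
    (hχ : ∃ a : (ZMod p)ˣ, (χ a : ℂ) ≠ sgmU p a) :
    charSpace p χ = Submodule.span ℂ {unitFun p χ} := by
  refine le_antisymm (fun f hf => ?_) ?_
  · refine Submodule.mem_span_singleton.mpr ⟨f 1, ?_⟩
    have h := eq_of_mem_charSpace hf
    rw [charSpace_apply_zero hf hχ, zero_smul, add_zero] at h
    exact h.symm
  · simpa using unitFun_mem_charSpace p χ

lemma charSpace_eq_span_pair (p : ℕ) [Fact p.Prime] (χ : (ZMod p)ˣ →* ℂˣ)
    (hχ : ∀ a : (ZMod p)ˣ, (χ a : ℂ) = sgmU p a) :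
    charSpace p χ = Submodule.span ℂ (Set.range ![unitFun p χ, Pi.single 0 1]) := by
  refine le_antisymm (fun f hf => ?_) ?_
  · rw [Matrix.range_cons_cons_empty]
    exact Submodule.mem_span_pair.mpr ⟨f 1, f 0, (eq_of_mem_charSpace hf).symm⟩
  · rw [Matrix.range_cons_cons_empty, Submodule.span_le]
    exact Set.pair_subset (unitFun_mem_charSpace p χ) (single_zero_mem_charSpace p χ hχ)

lemma linearIndependent_unitFun_single (p : ℕ) [Fact p.Prime] (χ : (ZMod p)ˣ →* ℂˣ) :
    LinearIndependent ℂ ![unitFun p χ, (Pi.single 0 1 : ZMod p → ℂ)] := by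
  refine LinearIndependent.pair_iff.mpr fun s t h => ⟨?_, ?_⟩
  · simpa [unitFun_one] using congrFun h 1
  · simpa [unitFun_zero] using congrFun h 0

/-- Character-space decomposition for the split torus: `dim H_χ = 1` for `χ ≠ σ` and
`dim H_χ = 2` for `χ = σ`. -/
theorem stmt14 (p : ℕ) [Fact p.Prime] (hp : p ≠ 2) (χ : (ZMod p)ˣ →* ℂˣ) :
    ((∃ a : (ZMod p)ˣ, (χ a : ℂ) ≠ sgmU p a) → Module.finrank ℂ (charSpace p χ) = 1) ∧
    ((∀ a : (ZMod p)ˣ, (χ a : ℂ) = sgmU p a) → Module.finrank ℂ (charSpace p χ) = 2) := by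
  refine ⟨fun hχ => ?_, fun hχ => ?_⟩
  · rw [charSpace_eq_span_unitFun p χ hχ]
    refine finrank_span_singleton fun h => ?_
    simpa [unitFun_one] using congrFun h 1
  · rw [charSpace_eq_span_pair p χ hχ,
      finrank_span_eq_card (linearIndependent_unitFun_single p χ), Fintype.card_fin]

end DFTWeil
end
end
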